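/- For every integer g ≥ 1, every τ ∈ ℍ_g and all m, a, b ∈ 𝔽₂^{2g}, the Riemann theta formula holds: (m,a,a)·(m,b,b)·(m,a,b)·θ_m(τ)·θ_{m+a}(τ)·θ_{m+b}(τ)·θ_{m+a+b}(τ) = 2^{−g}·Σ_{n∈𝔽₂^{2g}} e(m,n)·(n,a,a)·(n,b,b)·(n,a,b)·θ_n(τ)·θ_{n+a}(τ)·θ_{n+b}(τ)·θ_{n+a+b}(τ). -/

import Mathlib

open scoped BigOperators

noncomputable section

/-- The Siegel upper half-space: symmetric complex matrices with positive
definite imaginary part (indexed by a finite type `ι`). -/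
def Siegel (ι : Type) [Fintype ι] : Set (Matrix ι ι ℂ) :=
  {τ | τ.IsSymm ∧ ∀ v : ι → ℝ, v ≠ 0 → 0 < ∑ i, ∑ j, v i * (τ i j).im * v j}

/-- The theta function with characteristic `[ε, δ]`. -/
def theta {ι : Type} [Fintype ι] (ε δ : ι → ZMod 2) (τ : Matrix ι ι ℂ) (z : ι → ℂ) : ℂ :=
  ∑' n : ι → ℤ, Complex.exp ((Real.pi : ℂ) * Complex.I *
    ((∑ i, ∑ j, ((n i : ℂ) + ((ε i).val : ℂ) / 2) * τ i j * ((n j : ℂ) + ((ε j).val : ℂ) / 2)) +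
     2 * ∑ i, ((n i : ℂ) + ((ε i).val : ℂ) / 2) * (z i + ((δ i).val : ℂ) / 2)))

/-- A theta characteristic, an element of `𝔽₂^{2g}`. -/
abbrev Char2 (ι : Type) := (ι → ZMod 2) × (ι → ZMod 2)

/-- Theta function, with the characteristic as a pair. -/
def thetaChar {ι : Type} [Fintype ι] (m : Char2 ι) (τ : Matrix ι ι ℂ) (z : ι → ℂ) : ℂ :=
  theta m.1 m.2 τ z

/-- Theta constant. -/
def thetaConst {ι : Type} [Fintype ι] (m : Char2 ι) (τ : Matrix ι ι ℂ) : ℂ :=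
  thetaChar m τ 0

/-- The symmetric tricharacter `(a,b,c)` of Igusa. -/
def trichar {ι : Type} [Fintype ι] (a b c : Char2 ι) : ℂ :=
  Complex.exp ((Real.pi : ℂ) * Complex.I *
    ((∑ j, ((a.1 j).val * (b.2 j).val * (c.2 j).val
      + (a.2 j).val * (b.1 j).val * (c.2 j).val
      + (a.2 j).val * (b.2 j).val * (c.1 j).val : ℕ) : ℕ) : ℂ))

/-- `e(a,b) := (a,a,b)·(a,b,b)`. -/
def epair {ι : Type} [Fintype ι] (a b : Char2 ι) : ℂ :=
  trichar a a b * trichar a b b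


/-- The contribution of one coordinate to the exponent of `trichar`. -/
def trilin (a b c : ZMod 2 × ZMod 2) : ℕ :=
  a.1.val * b.2.val * c.2.val + a.2.val * b.1.val * c.2.val + a.2.val * b.2.val * c.1.val

/-- The coefficient of one coordinate in the theta series summed over doubled indices. -/
def localCoeff (c : ZMod 2 × ZMod 2) (x : ℤ) : ℂ :=
  if (x : ZMod 2) = c.1 then Complex.I ^ (x * (c.2.val : ℤ)) else 0

/-- The sign `(n,a,a)(n,b,b)(n,a,b)` restricted to one coordinate. -/
def localSign (n a b : ZMod 2 × ZMod 2) : ℂ :=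
  Complex.I ^ (2 * (trilin n a a + trilin n b b + trilin n a b : ℤ))

/-- The coefficient of one coordinate in the product of four theta series. -/
def localWeight (n a b : ZMod 2 × ZMod 2) (x₁ x₂ x₃ x₄ : ℤ) : ℂ :=
  localSign n a b * (localCoeff n x₁ * localCoeff (n + a) x₂ *
    (localCoeff (n + b) x₃ * localCoeff (n + a + b) x₄))

/-- The symplectic sign `e(m,n)` restricted to one coordinate. -/
def localPair (m n : ZMod 2 × ZMod 2) : ℂ :=
  Complex.I ^ (2 * (trilin m m n + trilin m n n : ℤ))

theorem I_zpow_congr {e f : ℤ} (h : e % 4 = f % 4) : Complex.I ^ e = Complex.I ^ f := by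
  obtain ⟨k, hk⟩ : ∃ k, e = 4 * k + f := ⟨(e - f) / 4, by omega⟩
  rw [hk, zpow_add₀ Complex.I_ne_zero, zpow_mul]
  norm_cast
  simp

theorem I_zpow_add_two {e f : ℤ} (h : e % 4 = (f + 2) % 4) :
    Complex.I ^ e = -Complex.I ^ f := by
  rw [I_zpow_congr h, zpow_add₀ Complex.I_ne_zero]
  norm_cast
  simp

theorem localWeight_eq_ite (n a b : ZMod 2 × ZMod 2) (x₁ x₂ x₃ x₄ : ℤ) :
    localWeight n a b x₁ x₂ x₃ x₄ =
      if (x₁ : ZMod 2) = n.1 ∧ (x₂ : ZMod 2) = n.1 + a.1 ∧ (x₃ : ZMod 2) = n.1 + b.1 ∧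
        (x₄ : ZMod 2) = n.1 + a.1 + b.1 then
        Complex.I ^ (2 * (trilin n a a + trilin n b b + trilin n a b : ℤ) +
          (x₁ * n.2.val + x₂ * (n.2 + a.2).val + (x₃ * (n.2 + b.2).val +
            x₄ * (n.2 + a.2 + b.2).val))) else 0 := by
  have h := Complex.I_ne_zero
  unfold localWeight localSign localCoeff
  split_ifs <;> simp_all [zpow_add₀]

theorem sum_localPair_mul_localWeight (m a b : ZMod 2 × ZMod 2) (x₁ x₂ x₃ x₄ y : ℤ)
    (hy : x₁ + x₂ + x₃ + x₄ = 2 * y) :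
    ∑ n, localPair m n * localWeight n a b x₁ x₂ x₃ x₄ =
      2 * localWeight m a b y (y - x₃ - x₄) (y - x₂ - x₄) (y - x₂ - x₃) := by
  obtain ⟨m₁, m₂⟩ := m
  obtain ⟨a₁, a₂⟩ := a
  obtain ⟨b₁, b₂⟩ := b
  have h2 : (2 : ZMod 2) = 0 := rfl
  simp only [localWeight_eq_ite, Fintype.sum_prod_type]
  by_cases hA : a₁ = ((x₃ + x₄ : ℤ) : ZMod 2) ∧ b₁ = ((x₂ + x₄ : ℤ) : ZMod 2)
  · obtain ⟨rfl, rfl⟩ := hA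
    rw [Finset.sum_eq_single (x₁ : ZMod 2)]
    · have hB : (x₂ : ZMod 2) = (x₁ : ZMod 2) + ((x₃ + x₄ : ℤ) : ZMod 2) ∧
          (x₃ : ZMod 2) = (x₁ : ZMod 2) + ((x₂ + x₄ : ℤ) : ZMod 2) ∧
          (x₄ : ZMod 2) = (x₁ : ZMod 2) + ((x₃ + x₄ : ℤ) : ZMod 2) +
            ((x₂ + x₄ : ℤ) : ZMod 2) := by
        refine ⟨?_, ?_, ?_⟩ <;> norm_cast <;>
          rw [ZMod.intCast_eq_intCast_iff_dvd_sub] <;> push_cast <;> omega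
      have hC : (y : ZMod 2) = m₁ → ((y - x₃ - x₄ : ℤ) : ZMod 2) =
            m₁ + ((x₃ + x₄ : ℤ) : ZMod 2) ∧
          ((y - x₂ - x₄ : ℤ) : ZMod 2) = m₁ + ((x₂ + x₄ : ℤ) : ZMod 2) ∧
          ((y - x₂ - x₃ : ℤ) : ZMod 2) = m₁ + ((x₃ + x₄ : ℤ) : ZMod 2) +
            ((x₂ + x₄ : ℤ) : ZMod 2) := by
        rintro rfl
        refine ⟨?_, ?_, ?_⟩ <;> norm_cast <;>
          rw [ZMod.intCast_eq_intCast_iff_dvd_sub] <;> push_cast <;> omega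
      have v0 : ZMod.val (0 : ZMod 2) = 0 := rfl
      have v1 : ZMod.val (1 : ZMod 2) = 1 := rfl
      have v11 : (1 + 1 : ZMod 2) = 0 := rfl
      have h01 : ∀ z : ZMod 2, z = 0 ∨ z = 1 := by decide
      have hsum : ∀ f : ZMod 2 → ℂ, ∑ z, f z = f 0 + f 1 := fun f => Fin.sum_univ_two f
      have hv : ∀ z : ℤ, ((z : ZMod 2).val : ℤ) = z % 2 := fun z => ZMod.val_intCast z
      simp only [hB, and_self, if_true, hsum, localPair, ← zpow_add₀ Complex.I_ne_zero]
      by_cases hm : (y : ZMod 2) = m₁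
      · rw [if_pos ⟨hm, hC hm⟩, two_mul (Complex.I ^ _)]
        subst hm
        rcases h01 m₂ with rfl | rfl <;> rcases h01 a₂ with rfl | rfl <;>
          rcases h01 b₂ with rfl | rfl <;> congr 1 <;> apply I_zpow_congr <;>
          simp only [trilin, v11, v0, v1, add_zero, zero_add, mul_zero, zero_mul, mul_one,
            one_mul, Nat.cast_add, Nat.cast_zero, Nat.cast_one, hv] <;> omega
      · rw [if_neg (fun h => hm h.1), mul_zero, add_eq_zero_iff_eq_neg]
        apply I_zpow_add_two
        have hne : ∀ u v : ZMod 2, u ≠ v → v = u + 1 := by decide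
        have hm' : m₁ = ((y + 1 : ℤ) : ZMod 2) := by
          rw [hne _ _ hm]
          push_cast
          rfl
        subst hm'
        rcases h01 m₂ with rfl | rfl <;> rcases h01 a₂ with rfl | rfl <;>
          rcases h01 b₂ with rfl | rfl <;>
          simp only [trilin, v11, v0, v1, add_zero, zero_add, mul_zero, zero_mul, mul_one,
            one_mul, Nat.cast_add, Nat.cast_zero, Nat.cast_one, hv] <;> omega
    · intro n₁ _ hn
      simp [Ne.symm hn]
    · simp
  · have hL : ∀ n₁ : ZMod 2, ¬ ((x₁ : ZMod 2) = n₁ ∧ (x₂ : ZMod 2) = n₁ + a₁ ∧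
        (x₃ : ZMod 2) = n₁ + b₁ ∧ (x₄ : ZMod 2) = n₁ + a₁ + b₁) := by
      rintro n₁ ⟨-, h₂, h₃, h₄⟩
      apply hA
      push_cast
      constructor
      · linear_combination -h₃ - h₄ - (n₁ + b₁) * h2
      · linear_combination -h₂ - h₄ - (n₁ + a₁) * h2
    have hR : ¬ ((y : ZMod 2) = m₁ ∧ ((y - x₃ - x₄ : ℤ) : ZMod 2) = m₁ + a₁ ∧
        ((y - x₂ - x₄ : ℤ) : ZMod 2) = m₁ + b₁ ∧
        ((y - x₂ - x₃ : ℤ) : ZMod 2) = m₁ + a₁ + b₁) := by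
      rintro ⟨h₁, h₂, h₃, h₄⟩
      apply hA
      push_cast at *
      constructor
      · linear_combination h₁ - h₂ - (x₃ + x₄) * h2
      · linear_combination h₁ - h₃ - (x₂ + x₄) * h2
    simp only [hL, hR, if_false, mul_zero, Finset.sum_const_zero]

theorem localWeight_eq_zero_of_odd (n a b : ZMod 2 × ZMod 2) {x₁ x₂ x₃ x₄ : ℤ}
    (h : ¬ Even (x₁ + x₂ + x₃ + x₄)) : localWeight n a b x₁ x₂ x₃ x₄ = 0 := by
  rw [localWeight_eq_ite, if_neg]
  rintro ⟨h₁, h₂, h₃, h₄⟩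
  apply h
  rw [← ZMod.intCast_eq_zero_iff_even]
  have h2 : (2 : ZMod 2) = 0 := rfl
  push_cast
  linear_combination h₁ + h₂ + h₃ + h₄ + (2 * n.1 + a.1 + b.1) * h2

theorem norm_localCoeff_le_one (c : ZMod 2 × ZMod 2) (x : ℤ) : ‖localCoeff c x‖ ≤ 1 := by
  unfold localCoeff
  split_ifs <;> simp

/-- The coordinate `j` of a characteristic. -/
def coordChar {ι : Type} (c : Char2 ι) (j : ι) : ZMod 2 × ZMod 2 := (c.1 j, c.2 j)

theorem trichar_eq_prod {ι : Type} [Fintype ι] (a b c : Char2 ι) :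
    trichar a b c =
      ∏ j, Complex.I ^ (2 * (trilin (coordChar a j) (coordChar b j) (coordChar c j) : ℤ)) := by
  have h : ∀ n : ℕ, Complex.I ^ (2 * (n : ℤ)) = Complex.exp ((Real.pi : ℂ) * Complex.I * n) := by
    intro n
    rw [zpow_mul, zpow_natCast, mul_comm _ (n : ℂ), Complex.exp_nat_mul, Complex.exp_pi_mul_I]
    norm_cast
    simp
  simp only [h, ← Complex.exp_sum, ← Finset.mul_sum, trichar, trilin, coordChar]
  norm_cast

theorem epair_eq_prod {ι : Type} [Fintype ι] (m n : Char2 ι) :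
    epair m n = ∏ j, localPair (coordChar m j) (coordChar n j) := by
  simp only [epair, trichar_eq_prod, localPair, mul_add, zpow_add₀ Complex.I_ne_zero,
    Finset.prod_mul_distrib]

theorem trichar_mul_eq_prod {ι : Type} [Fintype ι] (n a b : Char2 ι) :
    trichar n a a * trichar n b b * trichar n a b =
      ∏ j, localSign (coordChar n j) (coordChar a j) (coordChar b j) := by
  simp only [trichar_eq_prod, localSign, mul_add, zpow_add₀ Complex.I_ne_zero,
    Finset.prod_mul_distrib]

/-- The quadratic form of `τ` on integer vectors. -/
def intQuad {ι : Type} [Fintype ι] (τ : Matrix ι ι ℂ) (X : ι → ℤ) : ℂ :=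
  ∑ i, ∑ j, (X i : ℂ) * τ i j * (X j : ℂ)

/-- The Gaussian attached to `τ`, at the half-integer vector `X / 2`. -/
def halfGauss {ι : Type} [Fintype ι] (τ : Matrix ι ι ℂ) (X : ι → ℤ) : ℂ :=
  Complex.exp ((Real.pi : ℂ) * Complex.I / 4 * intQuad τ X)

/-- The terms of the theta series, indexed by doubled indices `X = 2n + ε`. -/
def thetaTerm {ι : Type} [Fintype ι] (τ : Matrix ι ι ℂ) (c : Char2 ι) (X : ι → ℤ) : ℂ :=
  (∏ j, localCoeff (coordChar c j) (X j)) * halfGauss τ X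

theorem I_zpow_eq_exp (k : ℤ) :
    Complex.I ^ k = Complex.exp ((Real.pi : ℂ) * Complex.I * (k / 2)) := by
  rw [show (Real.pi : ℂ) * Complex.I * (k / 2) = k * (Real.pi / 2 * Complex.I) by ring,
    Complex.exp_int_mul, Complex.exp_pi_div_two_mul_I]

theorem thetaConst_eq_tsum {ι : Type} [Fintype ι] (τ : Matrix ι ι ℂ) (c : Char2 ι) :
    thetaConst c τ = ∑' X, thetaTerm τ c X := by
  have hinj : Function.Injective
      (fun (n : ι → ℤ) (j : ι) => 2 * n j + ((c.1 j).val : ℤ)) := by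
    intro n n' h
    funext j
    have := congrFun h j
    simp only at this
    omega
  rw [← hinj.tsum_eq]
  · unfold thetaConst thetaChar theta
    congr 1
    funext n
    have hc : ∀ j, localCoeff (coordChar c j) (2 * n j + ((c.1 j).val : ℤ)) =
        Complex.exp ((Real.pi : ℂ) * Complex.I *
          (2 * (((n j : ℂ) + ((c.1 j).val : ℂ) / 2) * ((c.2 j).val / 2)))) := by
      intro j
      have h2 : (2 : ZMod 2) = 0 := rfl
      rw [localCoeff, if_pos, I_zpow_eq_exp]
      · congr 1
        simp only [coordChar]
        push_cast
        ring
      · simp [coordChar, h2]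
    simp only [thetaTerm, halfGauss, hc, ← Complex.exp_sum, ← Complex.exp_add]
    congr 1
    rw [← Finset.mul_sum, ← Finset.mul_sum, mul_add, add_comm]
    congr 1
    · simp only [Pi.zero_apply, zero_add]
    · rw [div_mul_eq_mul_div, mul_div_assoc]
      congr 1
      unfold intQuad
      simp only [Finset.sum_div]
      refine Finset.sum_congr rfl fun i _ => Finset.sum_congr rfl fun j _ => ?_
      push_cast
      ring
  · intro X hX
    have hpar : ∀ j, (X j : ZMod 2) = c.1 j := by
      intro j
      by_contra hj
      apply hX
      rw [thetaTerm, Finset.prod_eq_zero (Finset.mem_univ j), zero_mul]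
      simp [localCoeff, coordChar, hj]
    refine ⟨fun j => X j / 2, ?_⟩
    funext j
    have : ((c.1 j).val : ℤ) = X j % 2 := by
      rw [← hpar j]
      exact ZMod.val_intCast _
    simp only [this]
    omega

theorem summable_int_exp_neg_mul_sq {c : ℝ} (hc : 0 < c) :
    Summable fun n : ℤ => Real.exp (-c * (n : ℝ) ^ 2) := by
  refine (summable_pow_mul_jacobiTheta₂_term_bound 0 (div_pos hc Real.pi_pos) 0).congr fun n => ?_
  have hpi := Real.pi_ne_zero
  rw [pow_zero, one_mul]
  congr 1
  field_simp
  ring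

theorem summable_prod_apply_of_nonneg {f : ℤ → ℝ} (hf : Summable f) (h0 : ∀ n, 0 ≤ f n)
    (g : ℕ) : Summable fun X : Fin g → ℤ => ∏ i, f (X i) := by
  induction g with
  | zero => exact Summable.of_finite
  | succ g ih =>
    rw [← (Fin.consEquiv fun _ : Fin (g + 1) => ℤ).summable_iff]
    refine (hf.mul_of_nonneg ih h0 fun X => Finset.prod_nonneg fun i _ => h0 _).congr ?_
    intro x
    simp [Fin.prod_univ_succ, Fin.consEquiv]

theorem exists_pos_mul_sum_sq_le {ι : Type} [Fintype ι] {τ : Matrix ι ι ℂ}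
    (hτ : τ ∈ Siegel ι) :
    ∃ c : ℝ, 0 < c ∧ ∀ v : ι → ℝ, c * ∑ i, v i ^ 2 ≤ ∑ i, ∑ j, v i * (τ i j).im * v j := by
  set q : EuclideanSpace ℝ ι → ℝ := fun v => ∑ i, ∑ j, v i * (τ i j).im * v j with hq
  have hcont : ContinuousOn q (Metric.sphere 0 1) := by
    apply Continuous.continuousOn
    fun_prop
  obtain ⟨c, hc, h⟩ := (isCompact_sphere (0 : EuclideanSpace ℝ ι) 1).exists_forall_le' hcont
    (a := 0) (fun v hv => hτ.2 _ fun h0 => by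
      have : v = 0 := by
        ext i
        exact congrFun h0 i
      simp [this] at hv)
  refine ⟨c, hc, fun v => ?_⟩
  set w : EuclideanSpace ℝ ι := WithLp.toLp 2 v with hw
  have hnorm : ∑ i, v i ^ 2 = ‖w‖ ^ 2 := by
    rw [EuclideanSpace.norm_sq_eq]
    simp [hw]
  rw [hnorm]
  rcases eq_or_ne w 0 with h0 | h0
  · have hv : v = 0 := by
      funext i
      exact congrArg (fun u : EuclideanSpace ℝ ι => u i) h0
    simp [h0, hv]
  · have hpos : 0 < ‖w‖ := norm_pos_iff.mpr h0
    have hle := h (‖w‖⁻¹ • w) (by simp [norm_smul, hpos.ne'])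
    have hscale : q (‖w‖⁻¹ • w) = (∑ i, ∑ j, v i * (τ i j).im * v j) / ‖w‖ ^ 2 := by
      simp only [hq, hw, Finset.sum_div, PiLp.smul_apply, smul_eq_mul]
      refine Finset.sum_congr rfl fun i _ => Finset.sum_congr rfl fun j _ => ?_
      field_simp
    rw [hscale, le_div_iff₀ (by positivity)] at hle
    exact hle

theorem norm_halfGauss {ι : Type} [Fintype ι] (τ : Matrix ι ι ℂ) (X : ι → ℤ) :
    ‖halfGauss τ X‖ =
      Real.exp (-(Real.pi / 4) * ∑ i, ∑ j, (X i : ℝ) * (τ i j).im * (X j : ℝ)) := by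
  have him : (intQuad τ X).im = ∑ i, ∑ j, (X i : ℝ) * (τ i j).im * (X j : ℝ) := by
    simp [intQuad, Complex.im_sum, Complex.mul_im]
  rw [halfGauss, Complex.norm_exp, ← him]
  congr 1
  rw [show (Real.pi : ℂ) * Complex.I / 4 * intQuad τ X =
    ((Real.pi / 4 : ℝ) : ℂ) * (Complex.I * intQuad τ X) by push_cast; ring,
    Complex.re_ofReal_mul, Complex.I_mul_re]
  ring

theorem summable_norm_thetaTerm {g : ℕ} {τ : Matrix (Fin g) (Fin g) ℂ}
    (hτ : τ ∈ Siegel (Fin g)) (c : Char2 (Fin g)) : Summable fun X => ‖thetaTerm τ c X‖ := by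
  obtain ⟨k, hk, hle⟩ := exists_pos_mul_sum_sq_le hτ
  have hpi := Real.pi_pos
  refine Summable.of_nonneg_of_le (fun _ => norm_nonneg _) (fun X => ?_)
    (summable_prod_apply_of_nonneg (summable_int_exp_neg_mul_sq (c := Real.pi / 4 * k)
      (by positivity)) (fun _ => (Real.exp_pos _).le) g)
  rw [thetaTerm, norm_mul, norm_prod, norm_halfGauss]
  refine (mul_le_of_le_one_left (Real.exp_pos _).le
    (Finset.prod_le_one (fun _ _ => norm_nonneg _) fun _ _ => norm_localCoeff_le_one _ _)).trans ?_
  rw [← Real.exp_sum, Real.exp_le_exp, ← Finset.mul_sum]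
  have := mul_le_mul_of_nonneg_left (hle fun i => (X i : ℝ)) (by positivity : 0 ≤ Real.pi / 4)
  linarith

/-- Quadruples of integer vectors. -/
abbrev Quad (ι : Type) := ((ι → ℤ) × (ι → ℤ)) × ((ι → ℤ) × (ι → ℤ))

/-- The terms of the product of four theta series, including Igusa's sign. -/
def quadTerm {ι : Type} [Fintype ι] (τ : Matrix ι ι ℂ) (n a b : Char2 ι) (X : Quad ι) : ℂ :=
  (∏ j, localWeight (coordChar n j) (coordChar a j) (coordChar b j)
    (X.1.1 j) (X.1.2 j) (X.2.1 j) (X.2.2 j)) *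
    (halfGauss τ X.1.1 * halfGauss τ X.1.2 * (halfGauss τ X.2.1 * halfGauss τ X.2.2))

theorem quadTerm_eq {ι : Type} [Fintype ι] (τ : Matrix ι ι ℂ) (n a b : Char2 ι) (X : Quad ι) :
    quadTerm τ n a b X = trichar n a a * trichar n b b * trichar n a b *
      (thetaTerm τ n X.1.1 * thetaTerm τ (n + a) X.1.2 *
        (thetaTerm τ (n + b) X.2.1 * thetaTerm τ (n + a + b) X.2.2)) := by
  have hadd : ∀ (c d : Char2 ι) j, coordChar (c + d) j = coordChar c j + coordChar d j :=
    fun _ _ _ => rfl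
  simp only [quadTerm, thetaTerm, localWeight, trichar_mul_eq_prod, Finset.prod_mul_distrib, hadd]
  ring

theorem hasSum_quadTerm {g : ℕ} {τ : Matrix (Fin g) (Fin g) ℂ} (hτ : τ ∈ Siegel (Fin g))
    (n a b : Char2 (Fin g)) :
    HasSum (quadTerm τ n a b) (trichar n a a * trichar n b b * trichar n a b *
      (thetaConst n τ * thetaConst (n + a) τ * thetaConst (n + b) τ *
        thetaConst (n + a + b) τ)) := by
  have hs := summable_norm_thetaTerm hτ
  have h₁₂ := (hs n).mul_norm (hs (n + a))
  have h₃₄ := (hs (n + b)).mul_norm (hs (n + a + b))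
  have h := (summable_mul_of_summable_norm h₁₂ h₃₄).hasSum
  rw [← tsum_mul_tsum_of_summable_norm h₁₂ h₃₄, ← tsum_mul_tsum_of_summable_norm (hs _) (hs _),
    ← tsum_mul_tsum_of_summable_norm (hs _) (hs _)] at h
  simp only [← thetaConst_eq_tsum] at h
  rw [funext (quadTerm_eq τ n a b), mul_assoc (thetaConst n τ * _)]
  exact h.mul_left _

theorem even_of_quadTerm_ne_zero {ι : Type} [Fintype ι] {τ : Matrix ι ι ℂ} {n a b : Char2 ι}
    {X : Quad ι} (hX : quadTerm τ n a b X ≠ 0) (j : ι) :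
    Even (X.1.1 j + X.1.2 j + X.2.1 j + X.2.2 j) := by
  by_contra hj
  apply hX
  rw [quadTerm, Finset.prod_eq_zero (Finset.mem_univ j) (localWeight_eq_zero_of_odd _ _ _ hj),
    zero_mul]

/-- Parametrization of the quadruples with even sum by half of their sum and the last three
entries. -/
def halfSumParam {ι : Type} (Z : Quad ι) : Quad ι :=
  ((2 * Z.1.1 - Z.1.2 - Z.2.1 - Z.2.2, Z.1.2), (Z.2.1, Z.2.2))

/-- The parametrization `halfSumParam` followed by Riemann's orthogonal transformation. -/
def riemannParam {ι : Type} (Z : Quad ι) : Quad ι :=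
  ((Z.1.1, Z.1.1 - Z.2.1 - Z.2.2), (Z.1.1 - Z.1.2 - Z.2.2, Z.1.1 - Z.1.2 - Z.2.1))

theorem halfSumParam_injective {ι : Type} : Function.Injective (halfSumParam (ι := ι)) := by
  rintro ⟨⟨z₁, z₂⟩, z₃, z₄⟩ ⟨⟨w₁, w₂⟩, w₃, w₄⟩ h
  simp only [halfSumParam, Prod.mk.injEq] at h
  obtain ⟨⟨h₁, rfl⟩, rfl, rfl⟩ := h
  have : z₁ = w₁ := by
    funext j
    have := congrFun h₁ j
    simp at this
    omega
  rw [this]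

theorem riemannParam_injective {ι : Type} : Function.Injective (riemannParam (ι := ι)) := by
  rintro ⟨⟨z₁, z₂⟩, z₃, z₄⟩ ⟨⟨w₁, w₂⟩, w₃, w₄⟩ h
  simp only [riemannParam, Prod.mk.injEq] at h
  obtain ⟨⟨rfl, h₂⟩, h₃, h₄⟩ := h
  simp only [funext_iff, Pi.sub_apply] at h₂ h₃ h₄
  simp only [Prod.mk.injEq, funext_iff, true_and]
  refine ⟨fun j => ?_, fun j => ?_, fun j => ?_⟩ <;> have := h₂ j <;> have := h₃ j <;>
    have := h₄ j <;> omega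

theorem mem_range_halfSumParam {ι : Type} {X : Quad ι}
    (h : ∀ j, Even (X.1.1 j + X.1.2 j + X.2.1 j + X.2.2 j)) : X ∈ Set.range halfSumParam := by
  choose y hy using h
  refine ⟨((y, X.1.2), (X.2.1, X.2.2)), ?_⟩
  have : 2 * y - X.1.2 - X.2.1 - X.2.2 = X.1.1 := by
    funext j
    have := hy j
    simp
    omega
  simp only [halfSumParam, this]

theorem mem_range_riemannParam {ι : Type} {X : Quad ι}
    (h : ∀ j, Even (X.1.1 j + X.1.2 j + X.2.1 j + X.2.2 j)) : X ∈ Set.range riemannParam := by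
  obtain ⟨⟨x₁, x₂⟩, x₃, x₄⟩ := X
  choose y hy using h
  simp only at hy
  refine ⟨((x₁, x₁ + x₂ - y), (x₁ + x₃ - y, x₁ + x₄ - y)), ?_⟩
  simp only [riemannParam, Prod.mk.injEq, funext_iff, Pi.sub_apply, Pi.add_apply, true_and]
  refine ⟨fun j => ?_, fun j => ?_, fun j => ?_⟩ <;> have := hy j <;> omega

theorem halfGauss_riemannParam {ι : Type} [Fintype ι] (τ : Matrix ι ι ℂ) (Z : Quad ι) :
    halfGauss τ (riemannParam Z).1.1 * halfGauss τ (riemannParam Z).1.2 *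
        (halfGauss τ (riemannParam Z).2.1 * halfGauss τ (riemannParam Z).2.2) =
      halfGauss τ (halfSumParam Z).1.1 * halfGauss τ (halfSumParam Z).1.2 *
        (halfGauss τ (halfSumParam Z).2.1 * halfGauss τ (halfSumParam Z).2.2) := by
  simp only [halfGauss, ← Complex.exp_add, ← mul_add, intQuad, ← Finset.sum_add_distrib]
  congr 2
  refine Finset.sum_congr rfl fun i _ => Finset.sum_congr rfl fun j _ => ?_
  simp [riemannParam, halfSumParam]
  ring

theorem sum_char_prod {ι : Type} [Fintype ι] [DecidableEq ι] (f : ι → ZMod 2 × ZMod 2 → ℂ) :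
    ∑ n : Char2 ι, ∏ j, f j (coordChar n j) = ∏ j, ∑ c, f j c := by
  rw [Fintype.prod_sum]
  exact Fintype.sum_equiv (Equiv.arrowProdEquivProdArrow ι (fun _ => ZMod 2) fun _ => ZMod 2).symm
    _ _ fun _ => rfl

theorem sum_epair_mul_quadTerm {g : ℕ} (τ : Matrix (Fin g) (Fin g) ℂ) (m a b : Char2 (Fin g))
    (Z : Quad (Fin g)) :
    ∑ n, epair m n * quadTerm τ n a b (halfSumParam Z) =
      2 ^ g * quadTerm τ m a b (riemannParam Z) := by
  unfold quadTerm
  rw [halfGauss_riemannParam, ← mul_assoc (2 ^ g : ℂ)]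
  simp_rw [← mul_assoc (epair m _)]
  rw [← Finset.sum_mul]
  congr 1
  simp only [epair_eq_prod]
  simp only [← Finset.prod_mul_distrib]
  rw [sum_char_prod fun j c => localPair (coordChar m j) c * localWeight c (coordChar a j)
    (coordChar b j) ((halfSumParam Z).1.1 j) ((halfSumParam Z).1.2 j) ((halfSumParam Z).2.1 j)
    ((halfSumParam Z).2.2 j)]
  have hloc := fun j => sum_localPair_mul_localWeight (coordChar m j) (coordChar a j)
    (coordChar b j) ((halfSumParam Z).1.1 j) ((halfSumParam Z).1.2 j) ((halfSumParam Z).2.1 j)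
    ((halfSumParam Z).2.2 j) (Z.1.1 j) (by simp [halfSumParam]; ring)
  simp only [hloc, Finset.prod_mul_distrib, Finset.prod_const, Finset.card_univ, Fintype.card_fin]
  rfl

/-- Riemann's theta formula. -/
theorem riemann_theta_formula (g : ℕ) (hg : 1 ≤ g)
    (τ : Matrix (Fin g) (Fin g) ℂ) (hτ : τ ∈ Siegel (Fin g))
    (m a b : Char2 (Fin g)) :
    trichar m a a * trichar m b b * trichar m a b *
      (thetaConst m τ * thetaConst (m + a) τ * thetaConst (m + b) τ *
        thetaConst (m + a + b) τ) =
    (2 : ℂ)⁻¹ ^ g * ∑ n : Char2 (Fin g),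
      epair m n * trichar n a a * trichar n b b * trichar n a b *
        (thetaConst n τ * thetaConst (n + a) τ * thetaConst (n + b) τ *
          thetaConst (n + a + b) τ) := by
  have hR := fun n => (halfSumParam_injective.hasSum_iff (f := quadTerm τ n a b) fun X hX => by
    by_contra h
    exact hX (mem_range_halfSumParam (even_of_quadTerm_ne_zero h))).mpr (hasSum_quadTerm hτ n a b)
  have hL := (riemannParam_injective.hasSum_iff (f := quadTerm τ m a b) fun X hX => by
    by_contra h
    exact hX (mem_range_riemannParam (even_of_quadTerm_ne_zero h))).mpr (hasSum_quadTerm hτ m a b)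
  have hsum := hasSum_sum fun n (_ : n ∈ Finset.univ) => (hR n).mul_left (epair m n)
  simp only [Function.comp_apply, sum_epair_mul_quadTerm] at hsum
  have h := hsum.unique (hL.mul_left (2 ^ g))
  simp only [mul_assoc] at h ⊢
  rw [h, ← mul_assoc ((2 : ℂ)⁻¹ ^ g), ← mul_pow,
    inv_mul_cancel₀ two_ne_zero, one_pow, one_mul]
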